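/- arXiv:1306.1721 — 5 statements merged into one kernel-verified Lean document; each statement's English description precedes it below -/
import Mathlib

section
/- Let R be an algebraic curvature tensor on ℝ³ that additionally satisfies the first Bianchi identity R i j k l + R j k i l + R k i j l = 0 for all indices. Then the Riemann tensor decomposes as Riem = Ric ∧ g − (scal/4)(g ∧ g); explicitly, for all indices i, j, k, l one has R i j k l = ric i k · δ j l + ric j l · δ i k − ric i l · δ j k − ric j k · δ i l − (scal/2) · (δ i k · δ j l − δ i l · δ j k). -/
open Finset

/-- **Decomposition of the Riemann tensor in dimension three.**
An algebraic curvature tensor `R` on `ℝ³` (components in the standard orthonormal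
basis, indices `0, 1, 2` corresponding to the indices `1, 2, 3` of the text) which
satisfies the first Bianchi identity decomposes as
`Riem = Ric ∧ g − (scal/4)(g ∧ g)`, i.e. componentwise
`R i j k l = ric i k δ j l + ric j l δ i k − ric i l δ j k − ric j k δ i l
             − (scal/2)(δ i k δ j l − δ i l δ j k)`. -/
theorem riemann_decomposition_dim3
    (R : Fin 3 → Fin 3 → Fin 3 → Fin 3 → ℝ)
    (hR1 : ∀ i j k l, R i j k l = -R j i k l)
    (hR2 : ∀ i j k l, R i j k l = -R i j l k)
    (hR3 : ∀ i j k l, R i j k l = R k l i j)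
    (hBianchi : ∀ i j k l, R i j k l + R j k i l + R k i j l = 0)
    (ric : Fin 3 → Fin 3 → ℝ) (hric : ∀ i k, ric i k = ∑ j, R i j k j)
    (scal : ℝ) (hscal : scal = ∑ i, ric i i) :
    ∀ i j k l,
      R i j k l =
        ric i k * (if j = l then (1 : ℝ) else 0)
          + ric j l * (if i = k then (1 : ℝ) else 0)
          - ric i l * (if j = k then (1 : ℝ) else 0)
          - ric j k * (if i = l then (1 : ℝ) else 0)
          - (scal / 2) *
            ((if i = k then (1 : ℝ) else 0) * (if j = l then (1 : ℝ) else 0)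
              - (if i = l then (1 : ℝ) else 0) * (if j = k then (1 : ℝ) else 0)) := by
  have diag_left (i k l) : R i i k l = 0 := by linarith [hR1 i i k l]
  have diag_right (i j k) : R i j k k = 0 := by linarith [hR2 i j k k]
  have left₁₀ := hR1 1 0
  have left₂₀ := hR1 2 0
  have left₂₁ := hR1 2 1
  have right₁₀ (i j) := hR2 i j 1 0
  have right₂₀ (i j) := hR2 i j 2 0
  have right₂₁ (i j) := hR2 i j 2 1
  have pair₀₂₀₁ := hR3 0 2 0 1
  have pair₁₂₀₁ := hR3 1 2 0 1
  have pair₁₂₀₂ := hR3 1 2 0 2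
  clear hR1 hR2 hR3 hBianchi
  intro i j k l
  fin_cases i <;> fin_cases j <;> fin_cases k <;> fin_cases l <;>
    simp [hscal, hric, Fin.sum_univ_three, diag_left, diag_right, left₁₀, left₂₀, left₂₁,
      right₁₀, right₂₀, right₂₁, pair₀₂₀₁, pair₁₂₀₁, pair₁₂₀₂] <;>
    ring
end

section
/- Let R be an algebraic curvature tensor on ℝ³ that additionally satisfies the first Bianchi identity R i j k l + R j k i l + R k i j l = 0 for all indices. Then for all indices i, k the full quadratic contraction of the curvature tensor satisfies Σ_{j,l,m} (R i j l m) · (R k j l m) = 2 · scal · ric i k − 2 · Σ_j (ric i j) · (ric j k) + 2 · (Σ_{p,q} (ric p q)²) · δ i k − scal² · δ i k. (Equivalently, in dimension three the RG²ₐ-flow equation ∂ₜ g_{ik} = −2 R_{ik} − a R_{ijlm} R_k^{jlm} takes the form ∂ₜ g_{ik} = −2 R_{ik} − a (2 R R_{ik} − 2 R²_{ik} + 2 |Ric|² g_{ik} − R² g_{ik}) in an orthonormal frame.) -/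
open Finset

/-- **Quadratic curvature contraction in dimension three.**
For an algebraic curvature tensor `R` on `ℝ³` (components in the standard
orthonormal basis, indices `0, 1, 2` corresponding to `1, 2, 3` of the text)
satisfying the first Bianchi identity, the full quadratic contraction satisfies
`Σ_{j,l,m} R i j l m * R k j l m
   = 2 scal ric i k − 2 Σ_j ric i j ric j k + 2 |Ric|² δ i k − scal² δ i k`,
which is the fact underlying the form of the RG²ₐ-flow equation
`∂ₜ g_{ik} = −2 R_{ik} − a (2 R R_{ik} − 2 R²_{ik} + 2 |Ric|² g_{ik} − R² g_{ik})`
in an orthonormal frame. -/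
theorem quadratic_contraction_dim3
    (R : Fin 3 → Fin 3 → Fin 3 → Fin 3 → ℝ)
    (hR1 : ∀ i j k l, R i j k l = -R j i k l)
    (hR2 : ∀ i j k l, R i j k l = -R i j l k)
    (hR3 : ∀ i j k l, R i j k l = R k l i j)
    (hBianchi : ∀ i j k l, R i j k l + R j k i l + R k i j l = 0)
    (ric : Fin 3 → Fin 3 → ℝ) (hric : ∀ i k, ric i k = ∑ j, R i j k j)
    (scal : ℝ) (hscal : scal = ∑ i, ric i i) :
    ∀ i k,
      (∑ j, ∑ l, ∑ m, R i j l m * R k j l m) =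
        2 * scal * ric i k
          - 2 * ∑ j, ric i j * ric j k
          + 2 * (∑ p, ∑ q, (ric p q) ^ 2) * (if i = k then (1 : ℝ) else 0)
          - scal ^ 2 * (if i = k then (1 : ℝ) else 0) := by
  have hdiag₁ : ∀ i k l, R i i k l = 0 := fun i k l => by linarith [hR1 i i k l]
  have hdiag₂ : ∀ i j k, R i j k k = 0 := fun i j k => by linarith [hR2 i j k k]
  have h10₁ := hR1 1 0
  have h20₁ := hR1 2 0
  have h21₁ := hR1 2 1
  have h10₂ : ∀ i j, R i j 1 0 = -R i j 0 1 := fun i j => hR2 i j 1 0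
  have h20₂ : ∀ i j, R i j 2 0 = -R i j 0 2 := fun i j => hR2 i j 2 0
  have h21₂ : ∀ i j, R i j 2 1 = -R i j 1 2 := fun i j => hR2 i j 2 1
  have hswap₁ := hR3 0 2 0 1
  have hswap₂ := hR3 1 2 0 1
  have hswap₃ := hR3 1 2 0 2
  intro i k
  fin_cases i <;> fin_cases k <;>
    simp [hscal, hric, Fin.sum_univ_three, hdiag₁, hdiag₂, h10₁, h20₁, h21₁,
      h10₂, h20₂, h21₂, hswap₁, hswap₂, hswap₃] <;>
    ring
end

section
/- Let a ∈ ℝ and let R be an algebraic curvature tensor on ℝ³ with ric 2 3 = 0. Define the linear endomorphism S of the 6-dimensional real vector space of symmetric 3×3 real matrices by S(h) i k = h i k + δ i 1 · δ k 1 · (Σ_j h j j) − δ i 1 · h 1 k − δ k 1 · h 1 i + a · δ i 1 · Σ_{s,u} (R k s 1 u) · h s u − a · Σ_u (R k 1 1 u) · h i u + a · δ k 1 · Σ_{s,u} (R i s 1 u) · h s u − a · Σ_u (R i 1 1 u) · h k u. Then the characteristic polynomial of S equals X³ · (X − λ₁) · (X − λ₂) · (X − λ₃), where λ₁ = 1 +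 a·(scal − 2·ric 3 3), λ₂ = 1 + a·(scal − 2·ric 2 2), and λ₃ = 1 + a·ric 1 1. In particular, 0 is an eigenvalue of S of algebraic multiplicity exactly three whenever λ₁, λ₂, λ₃ are all nonzero. -/
open Finset Polynomial

/-- The submodule of symmetric `n × n` real matrices. -/
def symMatrices (n : ℕ) : Submodule ℝ (Matrix (Fin n) (Fin n) ℝ) where
  carrier := {A | A.IsSymm}
  add_mem' := fun ha hb => ha.add hb
  zero_mem' := Matrix.isSymm_zero
  smul_mem' := fun c _ hA => hA.smul c

/-- Coordinates on symmetric `3 × 3` matrices: the entries on and above the diagonal, ordered so that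
the first row comes first. -/
def symMatricesThreeEquiv : symMatrices 3 ≃ₗ[ℝ] (Fin 6 → ℝ) where
  toFun A := ![A.1 0 0, A.1 0 1, A.1 0 2, A.1 1 1, A.1 2 2, A.1 1 2]
  invFun v := ⟨!![v 0, v 1, v 2; v 1, v 3, v 5; v 2, v 5, v 4], by
    refine Matrix.IsSymm.ext fun i j => ?_
    fin_cases i <;> fin_cases j <;> rfl⟩
  map_add' A B := by
    ext i
    fin_cases i <;> rfl
  map_smul' c A := by
    ext i
    fin_cases i <;> rfl
  left_inv A := by
    have hA : A.1.IsSymm := A.2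
    ext i j
    fin_cases i <;> fin_cases j <;> simp <;> exact hA.apply _ _
  right_inv v := by
    ext i
    fin_cases i <;> rfl

/-- An endomorphism of a space with coordinates in `Fin n → ℝ` which is upper triangular in these
coordinates has the product of its diagonal factors as characteristic polynomial. -/
theorem charpoly_of_coord_upperTriangular {n : ℕ} {V : Type*} [AddCommGroup V] [Module ℝ V]
    (e : V ≃ₗ[ℝ] (Fin n → ℝ)) (f : V →ₗ[ℝ] V) (d : Fin n → ℝ)
    (h : ∀ i j, j ≤ i → e (f (e.symm (Pi.single j 1))) i = if i = j then d i else 0) :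
    have : Module.Finite ℝ V := Module.Finite.equiv e.symm
    have : Module.Free ℝ V := Module.Free.of_equiv e.symm
    f.charpoly = ∏ i, (X - C (d i)) := by
  intro _ _
  let b := Module.Basis.ofEquivFun e
  have hM : ∀ i j, LinearMap.toMatrix b b f i j = e (f (e.symm (Pi.single j 1))) i := by
    intro i j
    simp [b, LinearMap.toMatrix_apply]
  rw [← LinearMap.charpoly_toMatrix f b, Matrix.charpoly_of_isUpperTriangular]
  · refine Finset.prod_congr rfl fun i _ => ?_
    rw [hM, h i i le_rfl, if_pos rfl]
  · intro i j hij
    rw [hM, h i j (le_of_lt hij), if_neg (show i ≠ j from ne_of_gt hij)]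

/-- If `p = X ^ n * q` and `q` does not vanish at `0`, then `0` is a root of multiplicity `n`. -/
theorem rootMultiplicity_zero_X_pow_mul {q : ℝ[X]} (n : ℕ) (hq : q.eval 0 ≠ 0) :
    (X ^ n * q).rootMultiplicity 0 = n := by
  have hq0 : q ≠ 0 := by
    rintro rfl
    simp at hq
  rw [rootMultiplicity_mul (mul_ne_zero (pow_ne_zero _ X_ne_zero) hq0),
    rootMultiplicity_eq_zero (p := q) hq]
  simpa using rootMultiplicity_X_sub_C_pow (0 : ℝ) n

/-- **Characteristic polynomial of the principal symbol of the linearized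
RG²ₐ-flow operator.**  Let `R` be an algebraic curvature tensor on `ℝ³`
(components in the standard orthonormal basis; Lean indices `0, 1, 2` correspond
to the indices `1, 2, 3` of the text) with `ric 2 3 = 0`, and let `S` be the
linear endomorphism of the 6-dimensional space of symmetric `3 × 3` matrices
given by the principal symbol of the linearization of the RG²ₐ-flow operator in
the direction of the first coordinate covector.  Then the characteristic
polynomial of `S` is `X³ (X − λ₁)(X − λ₂)(X − λ₃)` with
`λ₁ = 1 + a(scal − 2 ric 3 3)`, `λ₂ = 1 + a(scal − 2 ric 2 2)`,
`λ₃ = 1 + a ric 1 1`; in particular `0` is an eigenvalue of `S` of algebraic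
multiplicity exactly three whenever `λ₁, λ₂, λ₃` are all nonzero. -/
theorem charpoly_symbol_RG2a
    (a : ℝ) (R : Fin 3 → Fin 3 → Fin 3 → Fin 3 → ℝ)
    (hR1 : ∀ i j k l, R i j k l = -R j i k l)
    (hR2 : ∀ i j k l, R i j k l = -R i j l k)
    (hR3 : ∀ i j k l, R i j k l = R k l i j)
    (ric : Fin 3 → Fin 3 → ℝ) (hric : ∀ i k, ric i k = ∑ j, R i j k j)
    (scal : ℝ) (hscal : scal = ∑ i, ric i i)
    (hric23 : ric 1 2 = 0)
    (S : symMatrices 3 →ₗ[ℝ] symMatrices 3)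
    (hS : ∀ h : symMatrices 3, ∀ i k,
      (S h : Matrix (Fin 3) (Fin 3) ℝ) i k =
        (h : Matrix (Fin 3) (Fin 3) ℝ) i k
          + (if i = 0 then (1 : ℝ) else 0) * (if k = 0 then (1 : ℝ) else 0) *
              (∑ j, (h : Matrix (Fin 3) (Fin 3) ℝ) j j)
          - (if i = 0 then (1 : ℝ) else 0) * (h : Matrix (Fin 3) (Fin 3) ℝ) 0 k
          - (if k = 0 then (1 : ℝ) else 0) * (h : Matrix (Fin 3) (Fin 3) ℝ) 0 i
          + a * (if i = 0 then (1 : ℝ) else 0) *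
              (∑ s, ∑ u, R k s 0 u * (h : Matrix (Fin 3) (Fin 3) ℝ) s u)
          - a * (∑ u, R k 0 0 u * (h : Matrix (Fin 3) (Fin 3) ℝ) i u)
          + a * (if k = 0 then (1 : ℝ) else 0) *
              (∑ s, ∑ u, R i s 0 u * (h : Matrix (Fin 3) (Fin 3) ℝ) s u)
          - a * (∑ u, R i 0 0 u * (h : Matrix (Fin 3) (Fin 3) ℝ) k u)) :
    LinearMap.charpoly S =
      X ^ 3 * (X - C (1 + a * (scal - 2 * ric 2 2)))
            * (X - C (1 + a * (scal - 2 * ric 1 1)))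
            * (X - C (1 + a * ric 0 0)) ∧
    (1 + a * (scal - 2 * ric 2 2) ≠ 0 → 1 + a * (scal - 2 * ric 1 1) ≠ 0 →
      1 + a * ric 0 0 ≠ 0 →
      (LinearMap.charpoly S).rootMultiplicity 0 = 3) := by
  have hself : ∀ i k l, R i i k l = 0 := fun i k l => by linarith [hR1 i i k l]
  have hself' : ∀ i j k, R i j k k = 0 := fun i j k => by linarith [hR2 i j k k]
  have hD : R 0 1 0 2 = 0 := by
    have h := hric 1 2
    simp only [hric23, Fin.sum_univ_three, hself, hself'] at h
    linarith [hR1 0 1 0 2, hR2 1 0 0 2]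
  have h1001 : R 1 0 0 1 = -R 0 1 0 1 := hR1 _ _ _ _
  have h2002 : R 2 0 0 2 = -R 0 2 0 2 := hR1 _ _ _ _
  have h1002 : R 1 0 0 2 = 0 := by rw [hR1, hD, neg_zero]
  have h2001 : R 2 0 0 1 = 0 := by rw [hR1, hR3, hD, neg_zero]
  have hswap : ∀ i j k l, R i j k l = R j i l k := fun i j k l => by
    rw [hR1, hR2, neg_neg]
  have hric0 : ric 0 0 = R 0 1 0 1 + R 0 2 0 2 := by
    rw [hric, Fin.sum_univ_three, hself, zero_add]
  have hric1 : ric 1 1 = R 0 1 0 1 + R 1 2 1 2 := by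
    rw [hric, Fin.sum_univ_three, hself, add_zero, hswap 1 0]
  have hric2 : ric 2 2 = R 0 2 0 2 + R 1 2 1 2 := by
    rw [hric, Fin.sum_univ_three, hself, add_zero, hswap 2 0, hswap 2 1]
  rw [Fin.sum_univ_three] at hscal
  have key := charpoly_of_coord_upperTriangular symMatricesThreeEquiv S
    ![0, 0, 0, 1 + a * (scal - 2 * ric 2 2), 1 + a * (scal - 2 * ric 1 1), 1 + a * ric 0 0] (by
      rw [hscal, hric0, hric1, hric2]
      intro i j hij
      fin_cases i <;> fin_cases j <;> first
        | exact absurd hij (by decide)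
        | (simp [symMatricesThreeEquiv, hS, Fin.sum_univ_three, hself, hself',
            h1001, h2002, h1002, h2001] <;> ring))
  have hchar : LinearMap.charpoly S = X ^ 3 * ((X - C (1 + a * (scal - 2 * ric 2 2)))
      * (X - C (1 + a * (scal - 2 * ric 1 1))) * (X - C (1 + a * ric 0 0))) := by
    rw [key]
    simp only [Fin.prod_univ_six, Matrix.cons_val, C_0, sub_zero]
    ring
  refine ⟨by rw [hchar]; ring, fun h1 h2 h3 => ?_⟩
  rw [hchar]
  refine rootMultiplicity_zero_X_pow_mul 3 ?_
  simp only [eval_mul, eval_sub, eval_X, eval_C, zero_sub]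
  exact mul_ne_zero (mul_ne_zero (neg_ne_zero.2 h1) (neg_ne_zero.2 h2)) (neg_ne_zero.2 h3)
end

section
/- Let n ≥ 2, a ∈ ℝ, and let R : Fin n → Fin n → Fin n → Fin n → ℝ satisfy R i j k l = −R i j l k for all indices (antisymmetry in the last two slots). Fix ξ, ν ∈ ℝⁿ and let h be the symmetric matrix h i k = ξ i · ν k + ν i · ξ k. Then the principal symbol of the linearized RG²ₐ-flow operator vanishes on h: for all indices i, k, |ξ|² · h i k + ξ i · ξ k · (Σ_j h j j) − ξ i · (Σ_t ξ t · h k t) − ξ k · (Σ_t ξ t · h i t) + a · Σ_{s,t,u} (R k s t u) · (ξ i · ξ t · h s u − ξ s · ξ t · h i u) + a · Σ_{s,t,u} (R i s t u) · (ξ k · ξ t · h s u − ξ s · ξ t · h k u) = 0. -/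
open Finset

/-- Contracting an antisymmetric array with a symmetric one gives zero. -/
theorem sum_sum_mul_eq_zero_of_antisymm_of_symm {ι : Type*} [Fintype ι] {A S : ι → ι → ℝ}
    (hA : ∀ t u, A t u = -A u t) (hS : ∀ t u, S t u = S u t) :
    ∑ t, ∑ u, A t u * S t u = 0 := by
  have key : ∑ t, ∑ u, A t u * S t u = -∑ t, ∑ u, A t u * S t u := by
    conv_lhs => rw [Finset.sum_comm]
    simp only [← Finset.sum_neg_distrib]
    refine Finset.sum_congr rfl fun t _ => Finset.sum_congr rfl fun u _ => ?_
    rw [hA u t, hS u t, neg_mul]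
  linarith

/-- The curvature part of the symbol vanishes on `h = ξ ⊗ ν + ν ⊗ ξ`. -/
theorem sum_curvature_symbol_eq_zero {ι : Type*} [Fintype ι] {R : ι → ι → ι → ℝ}
    (hR : ∀ s t u, R s t u = -R s u t) {ξ ν : ι → ℝ} {h : ι → ι → ℝ}
    (hh : ∀ i k, h i k = ξ i * ν k + ν i * ξ k) (i : ι) :
    ∑ s, ∑ t, ∑ u, R s t u * (ξ i * ξ t * h s u - ξ s * ξ t * h i u) = 0 := by
  refine Finset.sum_eq_zero fun s _ => ?_
  refine sum_sum_mul_eq_zero_of_antisymm_of_symm (hR s) fun t u => ?_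
  simp only [hh]
  ring

/-- **Diffeomorphism-invariance directions lie in the kernel of the principal symbol.**
Let `n ≥ 2`, `a ∈ ℝ` and let `R` be antisymmetric in its last two slots.  For any
covectors `ξ, ν ∈ ℝⁿ`, the symmetric matrix `h i k = ξ i ν k + ν i ξ k` (a variation
of the metric tangent to the orbit of the diffeomorphism group) is annihilated by
the principal symbol of the linearized RG²ₐ-flow operator. -/
theorem symbol_kernel_diffeo_directions
    (n : ℕ) (hn : 2 ≤ n) (a : ℝ)
    (R : Fin n → Fin n → Fin n → Fin n → ℝ)
    (hR : ∀ i j k l, R i j k l = -R i j l k)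
    (ξ ν : Fin n → ℝ)
    (h : Fin n → Fin n → ℝ) (hh : ∀ i k, h i k = ξ i * ν k + ν i * ξ k) :
    ∀ i k,
      (∑ t, ξ t * ξ t) * h i k
        + ξ i * ξ k * (∑ j, h j j)
        - ξ i * (∑ t, ξ t * h k t)
        - ξ k * (∑ t, ξ t * h i t)
        + a * (∑ s, ∑ t, ∑ u, R k s t u * (ξ i * ξ t * h s u - ξ s * ξ t * h i u))
        + a * (∑ s, ∑ t, ∑ u, R i s t u * (ξ k * ξ t * h s u - ξ s * ξ t * h k u))
      = 0 := by
  intro i k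
  have trace_h : ∑ j, h j j = 2 * ∑ t, ξ t * ν t := by
    rw [Finset.mul_sum]
    refine Finset.sum_congr rfl fun j _ => ?_
    rw [hh]
    ring
  have contract_h (m : Fin n) :
      ∑ t, ξ t * h m t = ξ m * ∑ t, ξ t * ν t + ν m * ∑ t, ξ t * ξ t := by
    rw [Finset.mul_sum, Finset.mul_sum, ← Finset.sum_add_distrib]
    refine Finset.sum_congr rfl fun t _ => ?_
    rw [hh]
    ring
  rw [sum_curvature_symbol_eq_zero (hR k) hh i, sum_curvature_symbol_eq_zero (hR i) hh k,
    trace_h, contract_h, contract_h, hh]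
  ring
end

section
/- Let n ≥ 2 and let r be a symmetric n×n real matrix such that r i j = 0 whenever i ≠ j and both i ≥ 2 and j ≥ 2 (indices running from 1 to n). Define the linear endomorphism T of the n(n+1)/2-dimensional real vector space of symmetric n×n matrices by T(h) i k = −(1/2) · [ r 1 k · (δ 1 i · (Σ_j h j j) − h 1 i) + r 1 i · (δ 1 k · (Σ_j h j j) − h 1 k) + Σ_j (r k j) · (h i j − δ 1 i · h 1 j) + Σ_j (r i j) · (h j k − δ 1 k · h 1 j) ]. Then the characteristic polynomial of T equals Xⁿ · ∏_{k=2}^{n} (X + r k k) · ∏_{2 ≤ i < k ≤ n} (X + (r i i + r k k)/2). In particular, all eigenvalues of −T are nonnegative if r k k ≥ 0 for all k ≥ 2. -/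
open Finset Polynomial

/-- A symmetric matrix is determined by its entries on and above the diagonal. -/
def symMatricesEquivFun (n : ℕ) :
    symMatrices n ≃ₗ[ℝ] ({p : Fin n ×ₗ Fin n // (ofLex p).1 ≤ (ofLex p).2} → ℝ) where
  toFun h p := (h : Matrix (Fin n) (Fin n) ℝ) (ofLex p.1).1 (ofLex p.1).2
  map_add' _ _ := rfl
  map_smul' _ _ := rfl
  invFun f := ⟨Matrix.of fun i k => f ⟨toLex (min i k, max i k), min_le_max⟩, by
    ext i k
    simp [Matrix.transpose_apply, min_comm, max_comm]⟩
  left_inv h := by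
    ext i k
    rcases le_total i k with hik | hik
    · simp [hik]
    · simpa [hik] using h.2.apply i k
  right_inv f := by
    ext ⟨p, hp⟩
    simp [hp]

section Symbol

variable {n : ℕ} [NeZero n] {r : Fin n → Fin n → ℝ}

lemma sum_row_mul_of_ne_zero (hdiag : ∀ i j : Fin n, i ≠ j → i ≠ 0 → j ≠ 0 → r i j = 0)
    {i : Fin n} (hi : i ≠ 0) (v : Fin n → ℝ) :
    ∑ j, r i j * v j = r i 0 * v 0 + r i i * v i := by
  refine Finset.sum_eq_add_of_mem 0 i (mem_univ _) (mem_univ _) hi.symm fun j _ hj => ?_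
  rw [hdiag i j hj.2.symm hi hj.1, zero_mul]

/-- The value of the principal symbol of the linearized squared Ricci operator. -/
noncomputable def squaredRicciSymbol (r h : Fin n → Fin n → ℝ) (i k : Fin n) : ℝ :=
  -(1 / 2) *
    (r 0 k * ((if i = 0 then (1 : ℝ) else 0) * (∑ j, h j j) - h 0 i)
      + r 0 i * ((if k = 0 then (1 : ℝ) else 0) * (∑ j, h j j) - h 0 k)
      + (∑ j, r k j * (h i j - (if i = 0 then (1 : ℝ) else 0) * h 0 j))
      + (∑ j, r i j * (h j k - (if k = 0 then (1 : ℝ) else 0) * h 0 j)))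

lemma squaredRicciSymbol_of_ne_zero (hsymm : ∀ i j, r i j = r j i)
    (hdiag : ∀ i j : Fin n, i ≠ j → i ≠ 0 → j ≠ 0 → r i j = 0)
    {h : Fin n → Fin n → ℝ} (hh : ∀ i j, h i j = h j i) {i k : Fin n} (hi : i ≠ 0) (hk : k ≠ 0) :
    squaredRicciSymbol r h i k = -((r i i + r k k) / 2) * h i k := by
  simp only [squaredRicciSymbol, hi, hk, if_false, zero_mul, sub_zero, zero_sub,
    sum_row_mul_of_ne_zero hdiag hi, sum_row_mul_of_ne_zero hdiag hk]
  rw [hsymm k 0, hsymm i 0, hh i 0]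
  ring

lemma squaredRicciSymbol_zero_left {h : Fin n → Fin n → ℝ} (hh : ∀ i j, h i j = h j i)
    (h0 : ∀ i j, i ≠ 0 → j ≠ 0 → h i j = 0) (k : Fin n) :
    squaredRicciSymbol r h 0 k = 0 := by
  have htr : ∑ j, h j j = h 0 0 := Fintype.sum_eq_single 0 fun j hj => h0 j j hj hj
  by_cases hk : k = 0
  · subst hk
    simp [squaredRicciSymbol, htr, hh _ 0]
  · have hs : ∑ j, r 0 j * h j k = r 0 0 * h 0 k :=
      Fintype.sum_eq_single 0 fun j hj => by rw [h0 j k hj hk, mul_zero]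
    simp [squaredRicciSymbol, htr, hk, hs]

end Symbol

/-- Splitting a product over pairs `i ≤ k` into `i = 0`, `0 < i = k` and `0 < i < k`. -/
lemma prod_le_pairs_eq {n : ℕ} [NeZero n] {M : Type*} [CommMonoid M] (f : Fin n × Fin n → M)
    {x : M} (hf : ∀ k, f (0, k) = x) :
    ∏ p : {p : Fin n ×ₗ Fin n // (ofLex p).1 ≤ (ofLex p).2}, f (ofLex p.1) =
      x ^ n * (∏ k ∈ Finset.univ.filter (fun k : Fin n => k ≠ 0), f (k, k)) *
        ∏ p ∈ Finset.univ.filter (fun p : Fin n × Fin n => p.1 ≠ 0 ∧ p.1 < p.2), f p := by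
  have hsub : ∏ p : {p : Fin n ×ₗ Fin n // (ofLex p).1 ≤ (ofLex p).2}, f (ofLex p.1) =
      ∏ p : Fin n × Fin n with p.1 ≤ p.2, f p :=
    Finset.prod_bij (fun p _ => ofLex p.1) (fun p _ => by simpa using p.2)
      (fun p _ q _ hpq => Subtype.ext (ofLex.injective hpq))
      (fun p hp => ⟨⟨toLex p, by simpa using hp⟩, mem_univ _, rfl⟩) (fun _ _ => rfl)
  have hrow : ∏ k : Fin n, f (0, k) = x ^ n := by simp [hf]
  rw [hsub, ← hrow]
  simp only [Finset.prod_filter, Fintype.prod_prod_type]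
  rw [← Fintype.prod_ite_eq (0 : Fin n) (fun _ => ∏ k : Fin n, f (0, k)),
    ← Finset.prod_mul_distrib, ← Finset.prod_mul_distrib]
  refine Finset.prod_congr rfl fun i _ => ?_
  by_cases hi : i = 0
  · subst hi
    simp
  · rw [if_neg (Ne.symm hi), one_mul, if_pos hi,
      ← Fintype.prod_ite_eq i (fun k => f (i, k)), ← Finset.prod_mul_distrib]
    refine Finset.prod_congr rfl fun k _ => ?_
    rcases lt_trichotomy i k with hik | hik | hik
    · simp [hi, hik, hik.le, hik.ne]
    · simp [hik]
    · simp [hik.not_ge, hik.not_gt, hik.ne']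

/-- **Characteristic polynomial of the principal symbol of the linearized squared
Ricci operator.**  Let `n ≥ 2` and let `r` be a symmetric `n × n` real matrix whose
off-diagonal entries vanish outside the first row and column (Lean indices
`0, …, n-1` correspond to the indices `1, …, n` of the text, so `r i j = 0` whenever
`i ≠ j`, `i ≠ 0` and `j ≠ 0`).  Let `T` be the endomorphism of the
`n(n+1)/2`-dimensional space of symmetric `n × n` matrices given by the principal
symbol, in the direction of the first coordinate covector, of the linearization of
the squared Ricci operator `H_{ik} = R_{ij} R^j_k`.  Then the characteristic
polynomial of `T` is `Xⁿ ∏_{k=2}^{n} (X + r k k) ∏_{2 ≤ i < k ≤ n} (X + (r i i + r k k)/2)`;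
in particular all eigenvalues of `−T` are nonnegative if `r k k ≥ 0` for all `k ≥ 2`. -/
theorem charpoly_symbol_squared_ricci
    (n : ℕ) (hn : 2 ≤ n) [NeZero n]
    (r : Fin n → Fin n → ℝ)
    (hsymm : ∀ i j, r i j = r j i)
    (hdiag : ∀ i j : Fin n, i ≠ j → i ≠ 0 → j ≠ 0 → r i j = 0)
    (T : symMatrices n →ₗ[ℝ] symMatrices n)
    (hT : ∀ h : symMatrices n, ∀ i k,
      (T h : Matrix (Fin n) (Fin n) ℝ) i k =
        -(1 / 2) *
          (r 0 k * ((if i = 0 then (1 : ℝ) else 0) *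
                (∑ j, (h : Matrix (Fin n) (Fin n) ℝ) j j)
              - (h : Matrix (Fin n) (Fin n) ℝ) 0 i)
            + r 0 i * ((if k = 0 then (1 : ℝ) else 0) *
                  (∑ j, (h : Matrix (Fin n) (Fin n) ℝ) j j)
                - (h : Matrix (Fin n) (Fin n) ℝ) 0 k)
            + (∑ j, r k j * ((h : Matrix (Fin n) (Fin n) ℝ) i j
                - (if i = 0 then (1 : ℝ) else 0) * (h : Matrix (Fin n) (Fin n) ℝ) 0 j))
            + (∑ j, r i j * ((h : Matrix (Fin n) (Fin n) ℝ) j k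
                - (if k = 0 then (1 : ℝ) else 0) * (h : Matrix (Fin n) (Fin n) ℝ) 0 j)))) :
    LinearMap.charpoly T =
      X ^ n * (∏ k ∈ Finset.univ.filter (fun k : Fin n => k ≠ 0), (X + C (r k k)))
            * (∏ p ∈ Finset.univ.filter
                  (fun p : Fin n × Fin n => p.1 ≠ 0 ∧ p.1 < p.2),
                (X + C ((r p.1 p.1 + r p.2 p.2) / 2))) ∧
    ((∀ k : Fin n, k ≠ 0 → 0 ≤ r k k) →
      ∀ μ : ℝ, Module.End.HasEigenvalue (-T) μ → 0 ≤ μ) := by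
  have hT' : ∀ (h : symMatrices n) i k,
      (T h : Matrix (Fin n) (Fin n) ℝ) i k = squaredRicciSymbol r h.1 i k := hT
  have hsym : ∀ (h : symMatrices n) i j, h.1 i j = h.1 j i := fun h i j => h.2.apply j i
  let b := Module.Basis.ofEquivFun (symMatricesEquivFun n)
  have hM : ∀ p q, LinearMap.toMatrix b b T p q =
      (T (b q) : Matrix (Fin n) (Fin n) ℝ) (ofLex p.1).1 (ofLex p.1).2 := fun p q => by
    rw [LinearMap.toMatrix_apply]
    rfl
  have hb : ∀ p q, (b q : Matrix (Fin n) (Fin n) ℝ) (ofLex p.1).1 (ofLex p.1).2 =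
      if p = q then 1 else 0 := fun p q =>
    (b.repr_self_apply q p).trans (if_congr eq_comm rfl rfl)
  have hb0 : ∀ q, (ofLex q.1).1 = 0 → ∀ i j, i ≠ 0 → j ≠ 0 →
      (b q : Matrix (Fin n) (Fin n) ℝ) i j = 0 := by
    intro q hq i j hi hj
    wlog hij : i ≤ j generalizing i j
    · rw [hsym]
      exact this j i hj hi (le_of_not_ge hij)
    · refine (hb ⟨toLex (i, j), hij⟩ q).trans (if_neg ?_)
      rintro rfl
      exact hi hq
  have hne : ∀ p : {p : Fin n ×ₗ Fin n // (ofLex p).1 ≤ (ofLex p).2},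
      (ofLex p.1).1 ≠ 0 → (ofLex p.1).2 ≠ 0 := fun p hp h2 =>
    hp (nonpos_iff_eq_zero.1 (h2 ▸ p.2))
  have hker : ∀ p q, (ofLex q.1).1 = 0 → LinearMap.toMatrix b b T p q = 0 := by
    intro p q hq
    rw [hM, hT']
    by_cases hp : (ofLex p.1).1 = 0
    · rw [hp]
      exact squaredRicciSymbol_zero_left (hsym _) (hb0 q hq) _
    · rw [squaredRicciSymbol_of_ne_zero hsymm hdiag (hsym _) hp (hne p hp),
        hb0 q hq _ _ hp (hne p hp), mul_zero]
  have hblock : ∀ p q, (ofLex p.1).1 ≠ 0 → LinearMap.toMatrix b b T p q =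
      if p = q then
        -((r (ofLex p.1).1 (ofLex p.1).1 + r (ofLex p.1).2 (ofLex p.1).2) / 2) else 0 := by
    intro p q hp
    rw [hM, hT', squaredRicciSymbol_of_ne_zero hsymm hdiag (hsym _) hp (hne p hp), hb]
    simp
  have htri : (LinearMap.toMatrix b b T).BlockTriangular id := by
    intro p q hqp
    by_cases hp : (ofLex p.1).1 = 0
    · refine hker p q (nonpos_iff_eq_zero.1 ?_)
      rw [← hp]
      exact Prod.Lex.monotone_fst _ _ (le_of_lt hqp)
    · rw [hblock p q hp, if_neg fun h => hqp.ne (congrArg id h.symm)]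
  have hchar : LinearMap.charpoly T =
      X ^ n * (∏ k ∈ Finset.univ.filter (fun k : Fin n => k ≠ 0), (X + C (r k k)))
            * (∏ p ∈ Finset.univ.filter
                  (fun p : Fin n × Fin n => p.1 ≠ 0 ∧ p.1 < p.2),
                (X + C ((r p.1 p.1 + r p.2 p.2) / 2))) := by
    let f : Fin n × Fin n → ℝ[X] := fun p =>
      if p.1 = 0 then X else X + C ((r p.1 p.1 + r p.2 p.2) / 2)
    have hf : ∀ p, X - C (LinearMap.toMatrix b b T p p) = f (ofLex p.1) := by
      intro p
      by_cases hp : (ofLex p.1).1 = 0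
      · simp [f, hker p p hp, hp]
      · simp only [f, hblock p p hp, hp, if_true, if_false, map_neg, sub_neg_eq_add]
    rw [← LinearMap.charpoly_toMatrix T b, Matrix.charpoly_of_isUpperTriangular _ htri,
      Finset.prod_congr rfl fun p _ => hf p, prod_le_pairs_eq f (x := X) fun k => if_pos rfl]
    congr 1
    · congr 1
      refine Finset.prod_congr rfl fun k hk => ?_
      simp [f, (Finset.mem_filter.1 hk).2]
    · refine Finset.prod_congr rfl fun p hp => ?_
      simp [f, (Finset.mem_filter.1 hp).2.1]
  refine ⟨hchar, fun hr μ hμ => ?_⟩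
  by_contra! hneg
  obtain ⟨v, hv⟩ := hμ.exists_hasEigenvector
  have hTv : T v = (-μ) • v := by
    rw [← neg_neg (T v), ← LinearMap.neg_apply, hv.apply_eq_smul]
    exact (neg_smul μ v).symm
  have hroot : (LinearMap.charpoly T).IsRoot (-μ) :=
    (Module.End.hasEigenvalue_iff_isRoot_charpoly T (-μ)).1
      (Module.End.hasEigenvalue_of_hasEigenvector
        (Module.End.hasEigenvector_iff.2 ⟨Module.End.mem_eigenspace_iff.2 hTv, hv.2⟩))
  refine absurd hroot (ne_of_gt ?_)
  simp only [hchar, eval_mul, eval_pow, eval_X, eval_prod, eval_add, eval_C]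
  have hμ' : 0 < -μ := neg_pos.2 hneg
  refine mul_pos (mul_pos (pow_pos hμ' n) (Finset.prod_pos fun k hk => ?_))
    (Finset.prod_pos fun p hp => ?_)
  · exact add_pos_of_pos_of_nonneg hμ' (hr k (Finset.mem_filter.1 hk).2)
  · obtain ⟨-, hp1, hlt⟩ := Finset.mem_filter.1 hp
    have hp2 : p.2 ≠ 0 := ((Fin.pos_iff_ne_zero.2 hp1).trans hlt).ne'
    have := hr _ hp1
    have := hr _ hp2
    positivity
end
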